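/- Let m ≥ 1 and for p = 1, …, m let A^p = (A^p_{ij})_{i,j=1}^s be a positive definite s×s block matrix over ℂ all of whose blocks A^p_{ij} are t_p × t_p matrices, and set σ_p := ( ∏_{q=1}^m t_q ) / t_p. Then equality holds in the inequality det(A^1 ∗ ⋯ ∗ A^m) ≥ ∏_{p=1}^m ∏_{i=1}^s det(A^p_{ii})^{σ_p} − ∏_{p=1}^m ( ∏_{i=1}^s det(A^p_{ii})^{σ_p} − det(A^p)^{σ_p} ) if and only if one of the following holds: (a) m = 1 or s = 1; (b) there exists a p such that A^p is block diagonal (A^p_{ij} = 0 for all i ≠ j); (c) t_p = 1 for every p, and there exist indices i ≠ j in {1, …, s} such that for every p, every entry A^p_{kl} with k ≠ l and {k, l} ≠ {i, j} is zero. -/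

import Mathlib

open scoped ComplexOrder

open Matrix in
/-- The Kronecker product of a finite family of square matrices. -/
def piKronecker {κ : Type*} [Fintype κ] {τ : κ → Type*}
    (X : ∀ p, Matrix (τ p) (τ p) ℂ) : Matrix (∀ p, τ p) (∀ p, τ p) ℂ :=
  of fun a b => ∏ p, X p (a p) (b p)

section Scalar

open Finset

variable {κ ι : Type*}

theorem add_sub_mul_le_prod (s : Finset κ) (u v : κ → ℝ)
    (hu : ∀ p, 0 ≤ u p) (hu' : ∀ p, u p ≤ 1) (hv : ∀ p, 0 ≤ v p) (hv' : ∀ p, v p ≤ 1) :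
    ∏ p ∈ s, u p + ∏ p ∈ s, v p - (∏ p ∈ s, u p) * ∏ p ∈ s, v p
      ≤ ∏ p ∈ s, (u p + v p - u p * v p) := by
  classical
  induction s using Finset.induction_on with
  | empty => simp
  | insert p s hp ih =>
    rw [prod_insert hp, prod_insert hp, prod_insert hp]
    have ha : 0 ≤ ∏ p ∈ s, u p := prod_nonneg fun p _ => hu p
    have ha' : ∏ p ∈ s, u p ≤ 1 := prod_le_one (fun p _ => hu p) fun p _ => hu' p
    have hb : 0 ≤ ∏ p ∈ s, v p := prod_nonneg fun p _ => hv p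
    have hb' : ∏ p ∈ s, v p ≤ 1 := prod_le_one (fun p _ => hv p) fun p _ => hv' p
    generalize ∏ p ∈ s, u p = a at *
    generalize ∏ p ∈ s, v p = b at *
    have h0 : 0 ≤ u p + v p - u p * v p := by nlinarith [hu p, hu' p, hv p, hv' p]
    have h1 := mul_le_mul_of_nonneg_left ih h0
    have h2 : 0 ≤ a * v p * ((1 - u p) * (1 - b)) :=
      mul_nonneg (mul_nonneg ha (hv p))
        (mul_nonneg (sub_nonneg.2 (hu' p)) (sub_nonneg.2 hb'))
    have h3 : 0 ≤ b * u p * ((1 - v p) * (1 - a)) :=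
      mul_nonneg (mul_nonneg hb (hu p))
        (mul_nonneg (sub_nonneg.2 (hv' p)) (sub_nonneg.2 ha'))
    nlinarith

theorem add_sub_mul_lt_prod [Fintype κ] (u v : κ → ℝ)
    (hu : ∀ p, 0 ≤ u p) (hu' : ∀ p, u p < 1) (hv : ∀ p, 0 ≤ v p) (hv' : ∀ p, v p < 1)
    (huv : ∀ p, 0 < u p + v p - u p * v p) {p q : κ} (hpq : p ≠ q)
    (hp : 0 < v p) (hq : 0 < u q) :
    ∏ p, u p + ∏ p, v p - (∏ p, u p) * ∏ p, v p < ∏ p, (u p + v p - u p * v p) := by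
  classical
  have hle := add_sub_mul_le_prod (univ.erase p) u v hu (fun p => (hu' p).le) hv
    fun p => (hv' p).le
  have hpos : 0 < ∏ r ∈ univ.erase p, (u r + v r - u r * v r) := prod_pos fun r _ => huv r
  have hqm : q ∈ univ.erase p := by simp [hpq.symm]
  have hb1 : ∏ r ∈ univ.erase p, v r < 1 := by
    rw [← mul_prod_erase _ _ hqm]
    have h1 : ∏ r ∈ (univ.erase p).erase q, v r ≤ 1 :=
      prod_le_one (fun r _ => hv r) fun r _ => (hv' r).le
    have h0 : 0 ≤ ∏ r ∈ (univ.erase p).erase q, v r := prod_nonneg fun r _ => hv r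
    nlinarith [hv q, hv' q]
  have ha1 : ∏ r ∈ univ.erase p, u r ≤ 1 :=
    prod_le_one (fun r _ => hu r) fun r _ => (hu' r).le
  have ha0 : 0 ≤ ∏ r ∈ univ.erase p, u r := prod_nonneg fun r _ => hu r
  have hb0 : 0 ≤ ∏ r ∈ univ.erase p, v r := prod_nonneg fun r _ => hv r
  have hstrict : 0 < ∏ r ∈ univ.erase p, v r →
      ∏ r ∈ univ.erase p, v r < ∏ r ∈ univ.erase p, (u r + v r - u r * v r) := by
    intro h
    have hvne : ∀ r ∈ univ.erase p, 0 < v r := fun r hr =>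
      lt_of_le_of_ne (hv r) fun h0 => h.ne' (prod_eq_zero hr h0.symm)
    refine prod_lt_prod hvne (fun r _ => ?_) ⟨q, hqm, ?_⟩
    · nlinarith [hu r, hv' r]
    · nlinarith [hv' q]
  rw [← mul_prod_erase univ u (mem_univ p), ← mul_prod_erase univ v (mem_univ p),
    ← mul_prod_erase univ (fun r => u r + v r - u r * v r) (mem_univ p)]
  generalize ∏ r ∈ univ.erase p, u r = a at *
  generalize ∏ r ∈ univ.erase p, v r = b at *
  generalize ∏ r ∈ univ.erase p, (u r + v r - u r * v r) = W at *
  have h1 := mul_le_mul_of_nonneg_left hle (huv p).le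
  have h3 : 0 ≤ b * u p * ((1 - v p) * (1 - a)) :=
    mul_nonneg (mul_nonneg hb0 (hu p))
      (mul_nonneg (sub_nonneg.2 (hv' p).le) (sub_nonneg.2 ha1))
  rcases ha0.eq_or_lt with rfl | ha
  · rcases hb0.eq_or_lt with rfl | hb
    · have := mul_pos (huv p) hpos
      nlinarith
    · have h4 := hstrict hb
      have h5 : v p ≤ u p + v p - u p * v p := by nlinarith [hu p, hv' p]
      have h6 := mul_lt_mul_of_pos_left h4 (huv p)
      nlinarith
  · have h2 : 0 < a * v p * ((1 - u p) * (1 - b)) :=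
      mul_pos (mul_pos ha hp) (mul_pos (sub_pos.2 (hu' p)) (sub_pos.2 hb1))
    nlinarith

theorem one_sub_prod_mem {s : Finset ι} {x : ι → ℝ} (h0 : ∀ i, 0 ≤ x i) (h1 : ∀ i, x i < 1) :
    0 ≤ 1 - ∏ i ∈ s, (1 - x i) ∧ 1 - ∏ i ∈ s, (1 - x i) < 1 := by
  constructor
  · exact sub_nonneg.2 (prod_le_one (fun i _ => (sub_pos.2 (h1 i)).le) fun i _ => by
      linarith [h0 i])
  · have : 0 < ∏ i ∈ s, (1 - x i) := prod_pos fun i _ => sub_pos.2 (h1 i)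
    linarith

theorem one_sub_prod_pos {s : Finset ι} {x : ι → ℝ} (h0 : ∀ i, 0 ≤ x i) (h1 : ∀ i, x i < 1)
    {i : ι} (hi : i ∈ s) (hx : 0 < x i) : 0 < 1 - ∏ i ∈ s, (1 - x i) := by
  classical
  rw [← mul_prod_erase _ _ hi]
  have := one_sub_prod_mem (s := s.erase i) h0 h1
  nlinarith [h1 i]

theorem one_sub_prod_one_sub_insert [DecidableEq ι] {s : Finset ι} {i : ι} (hi : i ∉ s)
    (x : ι → ℝ) :
    1 - ∏ j ∈ insert i s, (1 - x j)
      = (1 - ∏ j ∈ s, (1 - x j)) + x i - (1 - ∏ j ∈ s, (1 - x j)) * x i := by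
  rw [prod_insert hi]; ring

theorem one_sub_prod_le_prod_one_sub [Fintype κ] [Nonempty κ] (x : κ → ι → ℝ)
    (h0 : ∀ p i, 0 ≤ x p i) (h1 : ∀ p i, x p i < 1) (s : Finset ι) :
    1 - ∏ p, (1 - ∏ i ∈ s, (1 - x p i)) ≤ ∏ i ∈ s, (1 - ∏ p, x p i) := by
  classical
  induction s using Finset.induction_on with
  | empty => simp
  | insert i s hi ih =>
    simp_rw [one_sub_prod_one_sub_insert hi]
    rw [prod_insert hi]
    have h := add_sub_mul_le_prod univ (fun p => 1 - ∏ j ∈ s, (1 - x p j)) (fun p => x p i)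
      (fun p => (one_sub_prod_mem (h0 p) (h1 p)).1)
      (fun p => (one_sub_prod_mem (h0 p) (h1 p)).2.le) (fun p => h0 p i) (fun p => (h1 p i).le)
    have hV : ∏ p, x p i ≤ 1 := prod_le_one (fun p _ => h0 p i) fun p _ => (h1 p i).le
    nlinarith

theorem eq_of_one_sub_prod_eq [Fintype κ] [Fintype ι] (x : κ → ι → ℝ)
    (h0 : ∀ p i, 0 ≤ x p i) (h1 : ∀ p i, x p i < 1) (hne : ∀ p, ∃ i, 0 < x p i)
    (heq : ∏ i, (1 - ∏ p, x p i) = 1 - ∏ p, (1 - ∏ i, (1 - x p i)))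
    {p q : κ} (hpq : p ≠ q) {i j : ι} (hp : 0 < x p i) (hq : 0 < x q j) : i = j := by
  classical
  by_contra hij
  have : Nonempty κ := ⟨p⟩
  have hi : i ∉ univ.erase i := notMem_erase i univ
  have hu := insert_erase (mem_univ i)
  have ih := one_sub_prod_le_prod_one_sub x h0 h1 (univ.erase i)
  have hins := fun p => one_sub_prod_one_sub_insert hi (x p)
  rw [hu] at hins
  have hpos : ∀ r, 0 < 1 - ∏ j, (1 - x r j) := fun r => by
    obtain ⟨k, hk⟩ := hne r
    exact one_sub_prod_pos (h0 r) (h1 r) (mem_univ k) hk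
  simp_rw [hins] at heq hpos
  have h := add_sub_mul_lt_prod (fun p => 1 - ∏ j ∈ univ.erase i, (1 - x p j)) (fun p => x p i)
    (fun p => (one_sub_prod_mem (h0 p) (h1 p)).1)
    (fun p => (one_sub_prod_mem (h0 p) (h1 p)).2) (fun p => h0 p i) (fun p => h1 p i)
    hpos hpq hp (one_sub_prod_pos (h0 q) (h1 q) (by simp [Ne.symm hij]) hq)
  rw [← mul_prod_erase _ _ (mem_univ i)] at heq
  have hV : ∏ p, x p i ≤ 1 := prod_le_one (fun p _ => h0 p i) fun p _ => (h1 p i).le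
  nlinarith

theorem prod_pi_apply [Fintype κ] [DecidableEq κ] {τ : κ → Type*} [∀ p, Fintype (τ p)]
    {R : Type*} [CommMonoid R] (p : κ) (h : τ p → R) :
    ∏ a : ∀ p, τ p, h (a p) = (∏ b, h b) ^ ∏ q ∈ univ.erase p, Fintype.card (τ q) := by
  classical
  rw [← (Equiv.piSplitAt p τ).symm.prod_comp, Fintype.prod_prod_type]
  simp only [Equiv.piSplitAt_symm_apply, dite_true, prod_const, card_univ, Fintype.card_pi]
  rw [← prod_pow]
  congr! 2
  exact (Finset.prod_subtype _ (fun q => by simp) (fun q => Fintype.card (τ q))).symm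

end Scalar

namespace Matrix

section Diagonalization

variable {n : Type*} [Fintype n] [DecidableEq n]

theorem PosSemidef.exists_eq_mul_diagonal_mul {A : Matrix n n ℂ} (hA : A.PosSemidef) :
    ∃ (U : Matrix n n ℂ) (d : n → ℝ), U * Uᴴ = 1 ∧ (∀ i, 0 ≤ d i) ∧
      A = U * diagonal (fun i => (d i : ℂ)) * Uᴴ := by
  refine ⟨hA.1.eigenvectorUnitary, hA.1.eigenvalues, ?_, hA.eigenvalues_nonneg, ?_⟩
  · exact Unitary.coe_mul_star_self _
  · conv_lhs => rw [hA.1.spectral_theorem, Unitary.conjStarAlgAut_apply]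
    rfl

theorem mul_conjTranspose_sub_mul_diagonal_mul (P : Matrix n n ℂ) (x : n → ℝ) :
    P * Pᴴ - P * diagonal (fun i => (x i : ℂ)) * Pᴴ
      = P * diagonal (fun i => ((1 - x i : ℝ) : ℂ)) * Pᴴ := by
  have : diagonal (fun i => ((1 - x i : ℝ) : ℂ)) = 1 - diagonal (fun i => (x i : ℂ)) := by
    rw [← diagonal_one, diagonal_sub]; simp
  rw [this, Matrix.mul_sub, Matrix.sub_mul, Matrix.mul_one]

/-- Simultaneous diagonalization by congruence of a positive definite matrix `X` and a matrix
`0 ≤ Y < X`. -/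
theorem PosDef.exists_simultaneous_diagonalization {X Y : Matrix n n ℂ} (hX : X.PosDef)
    (hY : Y.PosSemidef) (hXY : (X - Y).PosDef) :
    ∃ (P : Matrix n n ℂ) (x : n → ℝ), (∀ i, 0 ≤ x i) ∧ (∀ i, x i < 1) ∧
      X = P * Pᴴ ∧ Y = P * diagonal (fun i => (x i : ℂ)) * Pᴴ := by
  obtain ⟨U, d, hU, hd, rfl⟩ := hX.posSemidef.exists_eq_mul_diagonal_mul
  obtain ⟨R, hRR⟩ : ∃ R, U * diagonal (fun i => (d i : ℂ)) * Uᴴ = R * Rᴴ := by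
    refine ⟨U * diagonal (fun i => (Real.sqrt (d i) : ℂ)), ?_⟩
    have h : diagonal (fun i => (d i : ℂ)) = diagonal (fun i => (Real.sqrt (d i) : ℂ)) *
        (diagonal (fun i => (Real.sqrt (d i) : ℂ)))ᴴ := by
      rw [diagonal_conjTranspose, diagonal_mul_diagonal]
      congr 1
      ext i
      simp only [Pi.star_apply, RCLike.star_def, Complex.conj_ofReal]
      rw [← Complex.ofReal_mul, Real.mul_self_sqrt (hd i)]
    rw [conjTranspose_mul, h]
    simp only [Matrix.mul_assoc]
  rw [hRR] at hX hXY ⊢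
  have hRu : IsUnit R := by
    have := hX.isUnit
    rw [isUnit_iff_isUnit_det, det_mul] at this
    rw [isUnit_iff_isUnit_det]
    exact isUnit_of_mul_isUnit_left this
  have hRd := (isUnit_iff_isUnit_det R).1 hRu
  have hRi : R * R⁻¹ = 1 := mul_nonsing_inv _ hRd
  have hRi' : R⁻¹ᴴ * Rᴴ = 1 := by rw [← conjTranspose_mul, hRi, conjTranspose_one]
  obtain ⟨V, x, hV, hx, hW⟩ := (hY.mul_mul_conjTranspose_same R⁻¹).exists_eq_mul_diagonal_mul
  have hVu : IsUnit V := IsUnit.of_mul_eq_one _ hV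
  have h1 : R * Rᴴ = (R * V) * (R * V)ᴴ := by
    rw [conjTranspose_mul, Matrix.mul_assoc, ← Matrix.mul_assoc V, hV, Matrix.one_mul]
  have h2 : Y = (R * V) * diagonal (fun i => (x i : ℂ)) * (R * V)ᴴ := by
    calc Y = (R * R⁻¹) * Y * (R⁻¹ᴴ * Rᴴ) := by rw [hRi, hRi', Matrix.one_mul, Matrix.mul_one]
      _ = R * (R⁻¹ * Y * R⁻¹ᴴ) * Rᴴ := by simp only [Matrix.mul_assoc]
      _ = _ := by rw [hW, conjTranspose_mul]; simp only [Matrix.mul_assoc]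
  refine ⟨R * V, x, hx, fun i => ?_, h1, h2⟩
  rw [h1, h2, mul_conjTranspose_sub_mul_diagonal_mul, ← star_eq_conjTranspose,
    Matrix.IsUnit.posDef_star_right_conjugate_iff (hRu.mul hVu), posDef_diagonal_iff] at hXY
  have := hXY i
  rw [Complex.zero_lt_real] at this
  linarith

theorem det_mul_conjTranspose_sub_mul_diagonal_mul (P : Matrix n n ℂ) (x : n → ℝ) :
    (P * Pᴴ - P * diagonal (fun i => (x i : ℂ)) * Pᴴ).det
      = (P * Pᴴ).det * ((∏ i, (1 - x i) : ℝ) : ℂ) := by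
  rw [mul_conjTranspose_sub_mul_diagonal_mul, det_mul, det_mul, det_mul, det_diagonal,
    ← Complex.ofReal_prod]
  ring

theorem PosSemidef.det_le_det_add {X Y : Matrix n n ℂ} (hX : X.PosSemidef)
    (hY : Y.PosSemidef) : X.det ≤ (X + Y).det := by
  by_cases hX0 : X.det = 0
  · rw [hX0]
    exact (hX.add hY).det_nonneg
  replace hX := hX.posDef_iff_det_ne_zero.2 hX0
  have hXY := hX.add_posSemidef hY
  obtain ⟨P, x, h0, h1, hP, hx⟩ :=
    hXY.exists_simultaneous_diagonalization hY (by simpa using hX)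
  have h : X = P * Pᴴ - P * diagonal (fun i => (x i : ℂ)) * Pᴴ := by
    rw [← hP, ← hx, add_sub_cancel_right]
  have hle : ((∏ i, (1 - x i) : ℝ) : ℂ) ≤ 1 := by
    rw [← Complex.ofReal_one, Complex.real_le_real]
    exact Finset.prod_le_one (fun i _ => (sub_pos.2 (h1 i)).le) fun i _ => by linarith [h0 i]
  calc X.det = (X + Y).det * ((∏ i, (1 - x i) : ℝ) : ℂ) := by
        rw [h, det_mul_conjTranspose_sub_mul_diagonal_mul, ← h, hP]
    _ ≤ (X + Y).det * 1 := mul_le_mul_of_nonneg_left hle hXY.det_pos.le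
    _ = _ := mul_one _

end Diagonalization

section Kronecker

variable {κ : Type*} [Fintype κ] {τ : κ → Type*}

theorem piKronecker_conjTranspose (X : ∀ p, Matrix (τ p) (τ p) ℂ) :
    (piKronecker X)ᴴ = piKronecker fun p => (X p)ᴴ := by
  ext a b
  simp [piKronecker, conjTranspose_apply]

theorem piKronecker_diagonal [∀ p, DecidableEq (τ p)] [DecidableEq (∀ p, τ p)]
    (d : ∀ p, τ p → ℂ) :
    piKronecker (fun p => diagonal (d p)) = diagonal fun a => ∏ p, d p (a p) := by
  ext a b
  rw [piKronecker, of_apply]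
  by_cases h : a = b
  · subst h; simp
  · rw [diagonal_apply_ne _ h]
    obtain ⟨p, hp⟩ := Function.ne_iff.1 h
    exact Finset.prod_eq_zero (Finset.mem_univ p) (diagonal_apply_ne _ hp)

variable [DecidableEq κ] [∀ p, Fintype (τ p)] [∀ p, DecidableEq (τ p)]

omit [∀ p, DecidableEq (τ p)] in
theorem piKronecker_mul (X Y : ∀ p, Matrix (τ p) (τ p) ℂ) :
    piKronecker X * piKronecker Y = piKronecker fun p => X p * Y p := by
  ext a b
  simp only [piKronecker, of_apply, mul_apply]
  rw [Finset.prod_univ_sum, Fintype.piFinset_univ]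
  exact Finset.sum_congr rfl fun c _ => Finset.prod_mul_distrib.symm

theorem piKronecker_mul_diagonal_mul (U : ∀ p, Matrix (τ p) (τ p) ℂ) (d : ∀ p, τ p → ℝ) :
    piKronecker (fun p => U p * diagonal (fun i => (d p i : ℂ)) * (U p)ᴴ)
      = piKronecker U * diagonal (fun a => ((∏ p, d p (a p) : ℝ) : ℂ)) * (piKronecker U)ᴴ := by
  rw [piKronecker_conjTranspose]
  have h := piKronecker_diagonal fun p i => (d p i : ℂ)
  simp only [← Complex.ofReal_prod] at h
  rw [← h, piKronecker_mul, piKronecker_mul]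

theorem PosSemidef.piKronecker {X : ∀ p, Matrix (τ p) (τ p) ℂ} (hX : ∀ p, (X p).PosSemidef) :
    (piKronecker X).PosSemidef := by
  choose U d _ hd h using fun p => (hX p).exists_eq_mul_diagonal_mul
  rw [show X = _ from funext h, piKronecker_mul_diagonal_mul]
  refine PosSemidef.mul_mul_conjTranspose_same (PosSemidef.diagonal fun a => ?_) _
  simp only [Pi.zero_apply, Complex.zero_le_real]
  exact Finset.prod_nonneg fun p _ => hd p _

theorem PosSemidef.det_piKronecker {X : ∀ p, Matrix (τ p) (τ p) ℂ}
    (hX : ∀ p, (X p).PosSemidef) :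
    (_root_.piKronecker X).det
      = ∏ p, (X p).det ^ ∏ q ∈ Finset.univ.erase p, Fintype.card (τ q) := by
  choose U d hU hd h using fun p => (hX p).exists_eq_mul_diagonal_mul
  have hone : _root_.piKronecker (fun p => (1 : Matrix (τ p) (τ p) ℂ)) = 1 := by
    have := piKronecker_diagonal fun (p : κ) (_ : τ p) => (1 : ℂ)
    simpa using this
  have hdet : ∀ p, (X p).det = ∏ i, (d p i : ℂ) := fun p => by
    rw [h p, det_mul_right_comm, hU, Matrix.one_mul, det_diagonal]
  simp_rw [hdet]
  rw [show X = _ from funext h, piKronecker_mul_diagonal_mul, det_mul_right_comm,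
    piKronecker_conjTranspose, piKronecker_mul]
  simp_rw [hU]
  rw [hone, Matrix.one_mul, det_diagonal]
  simp_rw [Complex.ofReal_prod]
  rw [Finset.prod_comm]
  exact Finset.prod_congr rfl fun p _ => prod_pi_apply p fun i => (d p i : ℂ)

theorem PosDef.piKronecker {X : ∀ p, Matrix (τ p) (τ p) ℂ} (hX : ∀ p, (X p).PosDef) :
    (piKronecker X).PosDef := by
  rw [(PosSemidef.piKronecker fun p => (hX p).posSemidef).posDef_iff_det_ne_zero,
    PosSemidef.det_piKronecker fun p => (hX p).posSemidef, Finset.prod_ne_zero_iff]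
  exact fun p _ => pow_ne_zero _ (hX p).det_pos.ne'

end Kronecker

section Schur

variable {α β : Type*} [Fintype α] [DecidableEq α] [Fintype β] [DecidableEq β]

/-- A positive semidefinite correction `Y` such that replacing the lower right block of a
positive definite matrix by `Y` leaves it positive semidefinite bounds the Schur complement. -/
theorem PosDef.exists_schur {N : Matrix (α ⊕ β) (α ⊕ β) ℂ} (hN : N.PosDef) :
    ∃ Y : Matrix β β ℂ, Y.PosSemidef ∧ (N.toBlocks₂₂ - Y).PosDef ∧
      N.det = N.toBlocks₁₁.det * (N.toBlocks₂₂ - Y).det ∧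
      (Y = 0 → N.toBlocks₁₂ = 0) ∧
      (fromBlocks N.toBlocks₁₁ N.toBlocks₁₂ N.toBlocks₂₁ Y).PosSemidef ∧
      ∀ Z, (fromBlocks N.toBlocks₁₁ N.toBlocks₁₂ N.toBlocks₂₁ Z).PosSemidef →
        (Z - Y).PosSemidef := by
  have hE : N.toBlocks₁₁.PosDef := hN.submatrix Sum.inl_injective
  have hF : N.toBlocks₂₁ = N.toBlocks₁₂ᴴ := by
    ext i j
    exact (hN.1.apply (Sum.inr i) (Sum.inl j)).symm
  have hNb := N.fromBlocks_toBlocks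
  rw [hF] at hNb ⊢
  set E := N.toBlocks₁₁
  set F := N.toBlocks₁₂
  set G := N.toBlocks₂₂
  let _ : Invertible E := hE.isUnit.invertible
  have hpsd : (Fᴴ * E⁻¹ * F).PosSemidef := hE.inv.posSemidef.conjTranspose_mul_mul_same F
  have hdet : N.det = E.det * (G - Fᴴ * E⁻¹ * F).det := by
    rw [← hNb, det_fromBlocks₁₁, invOf_eq_nonsing_inv]
  refine ⟨Fᴴ * E⁻¹ * F, hpsd, ?_, hdet, fun h => ?_, ?_, fun Z hZ => ?_⟩
  · have h1 : (G - Fᴴ * E⁻¹ * F).PosSemidef := by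
      rw [← PosDef.fromBlocks₁₁ F G hE, hNb]
      exact hN.posSemidef
    rw [h1.posDef_iff_det_ne_zero]
    intro h0
    rw [h0, mul_zero] at hdet
    exact hN.det_pos.ne' hdet
  · ext i j
    by_contra hij
    have hv : (F.col j) ≠ 0 := fun h0 => hij (congrFun h0 i)
    have := hE.inv.dotProduct_mulVec_pos hv
    have h2 : star (F.col j) ⬝ᵥ (E⁻¹ *ᵥ F.col j) = (Fᴴ * E⁻¹ * F) j j := by
      rw [Matrix.mul_assoc, mul_apply']
      rfl
    rw [h2, h] at this
    simp at this
  · rw [PosDef.fromBlocks₁₁ F _ hE, sub_self]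
    exact PosSemidef.zero
  · rwa [PosDef.fromBlocks₁₁ F Z hE] at hZ

end Schur

end Matrix

section KhatriRao

open Matrix Finset

/-- The Khatri–Rao product of a finite family of block matrices with square blocks. -/
def khatriRao {κ ι : Type*} [Fintype κ] {τ : κ → Type*}
    (A : ∀ p, Matrix (ι × τ p) (ι × τ p) ℂ) : Matrix (ι × ∀ p, τ p) (ι × ∀ p, τ p) ℂ :=
  of fun x y => ∏ p, A p (x.1, x.2 p) (y.1, y.2 p)

/-- The diagonal block of a block matrix at a given index. -/
def diagBlock {ι β : Type*} (A : Matrix (ι × β) (ι × β) ℂ) (k : ι) : Matrix β β ℂ :=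
  of fun x y => A (k, x) (k, y)

/-- Splitting off the last block of an index set of blocks. -/
def finSuccProdEquiv (s : ℕ) (β : Type*) : (Fin s × β) ⊕ β ≃ Fin (s + 1) × β where
  toFun := Sum.elim (fun x => (x.1.castSucc, x.2)) fun b => (Fin.last s, b)
  invFun x := Fin.lastCases (motive := fun _ => (Fin s × β) ⊕ β) (Sum.inr x.2)
    (fun i => Sum.inl (i, x.2)) x.1
  left_inv x := by rcases x with x | x <;> simp
  right_inv x := by
    obtain ⟨i, b⟩ := x
    induction i using Fin.lastCases <;> simp

variable {κ : Type*} [Fintype κ] [DecidableEq κ] {τ : κ → Type*} [∀ p, Fintype (τ p)]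
  [∀ p, DecidableEq (τ p)]

theorem Matrix.PosDef.diagBlock {ι β : Type*} {A : Matrix (ι × β) (ι × β) ℂ} (hA : A.PosDef)
    (k : ι) : (diagBlock A k).PosDef :=
  hA.submatrix (Prod.mk_right_injective k)

theorem Matrix.PosDef.khatriRao [Nonempty κ] {ι : Type*} [Fintype ι] [DecidableEq ι]
    {A : ∀ p, Matrix (ι × τ p) (ι × τ p) ℂ}
    (hA : ∀ p, (A p).PosDef) : (khatriRao A).PosDef := by
  have h : Function.Injective fun (x : ι × ∀ p, τ p) (p : κ) => (x.1, x.2 p) := by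
    rintro ⟨i, a⟩ ⟨j, b⟩ h
    obtain ⟨p⟩ := ‹Nonempty κ›
    refine Prod.ext ((Prod.ext_iff.1 (congrFun h p)).1) (funext fun q => ?_)
    exact (Prod.ext_iff.1 (congrFun h q)).2
  exact (PosDef.piKronecker hA).submatrix h

theorem exists_khatriRao_det_bound [Nonempty κ] (s : ℕ)
    (A : ∀ p, Matrix (Fin s × τ p) (Fin s × τ p) ℂ) (hA : ∀ p, (A p).PosDef) :
    ∃ x : ∀ p, Fin s → τ p → ℝ, (∀ p k a, 0 ≤ x p k a) ∧ (∀ p k a, x p k a < 1) ∧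
      (∀ p k, (∀ a, x p k a = 0) → ∀ l < k, ∀ a b, A p (l, a) (k, b) = 0) ∧
      (∀ p, (A p).det
        = (∏ k, (diagBlock (A p) k).det) * ((∏ k, ∏ a, (1 - x p k a) : ℝ) : ℂ)) ∧
      (∏ k, (piKronecker fun p => diagBlock (A p) k).det) *
        ((∏ k, ∏ a : ∀ p, τ p, (1 - ∏ p, x p k (a p)) : ℝ) : ℂ) ≤ (khatriRao A).det := by
  induction s with
  | zero =>
    exact ⟨fun _ _ _ => 0, by simp, by simp, fun _ k => k.elim0, by simp, by simp⟩
  | succ s ih =>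
    set N : ∀ p, Matrix ((Fin s × τ p) ⊕ τ p) ((Fin s × τ p) ⊕ τ p) ℂ :=
      fun p => (A p).submatrix (finSuccProdEquiv s (τ p)) (finSuccProdEquiv s (τ p)) with hNdef
    have hN : ∀ p, (N p).PosDef := fun p => (hA p).submatrix (Equiv.injective _)
    obtain ⟨x', h0', h1', hz', hd', hb'⟩ := ih (fun p => (N p).toBlocks₁₁)
      fun p => (hN p).submatrix Sum.inl_injective
    choose Y hY hS hdet hY0 hNY _ using fun p => (hN p).exists_schur
    choose P y hy0 hy1 hPG hPY using fun p =>
      PosDef.exists_simultaneous_diagonalization (X := (N p).toBlocks₂₂)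
        ((hN p).submatrix Sum.inr_injective) (hY p) (hS p)
    set M := (khatriRao A).submatrix (finSuccProdEquiv s (∀ p, τ p))
      (finSuccProdEquiv s (∀ p, τ p)) with hMdef
    have hM : M.PosDef := (PosDef.khatriRao hA).submatrix (Equiv.injective _)
    have hM22 : M.toBlocks₂₂ = piKronecker fun p => (N p).toBlocks₂₂ := rfl
    have hM11 : M.toBlocks₁₁ = khatriRao fun p => (N p).toBlocks₁₁ := rfl
    obtain ⟨YM, -, -, hdetM, -, -, hmax⟩ := hM.exists_schur
    have hYM : (piKronecker Y - YM).PosSemidef := by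
      apply hmax
      have h := (PosSemidef.piKronecker hNY).submatrix
        (Sum.elim (fun x p => Sum.inl (x.1, x.2 p)) (fun a p => Sum.inr (a p)) :
          (Fin s × ∀ p, τ p) ⊕ (∀ p, τ p) → ∀ p, (Fin s × τ p) ⊕ τ p)
      convert! h using 1
      ext a b
      rcases a with a | a <;> rcases b with b | b <;> rfl
    have hlast : M.toBlocks₂₂.det *
        ((∏ a : ∀ p, τ p, (1 - ∏ p, y p (a p)) : ℝ) : ℂ) ≤ (M.toBlocks₂₂ - YM).det := by
      have hG : piKronecker (fun p => (N p).toBlocks₂₂)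
          = piKronecker P * (piKronecker P)ᴴ := by
        rw [piKronecker_conjTranspose, piKronecker_mul]
        exact congrArg piKronecker (funext hPG)
      have hK : piKronecker Y = piKronecker P *
          diagonal (fun a => ((∏ p, y p (a p) : ℝ) : ℂ)) * (piKronecker P)ᴴ := by
        rw [← piKronecker_mul_diagonal_mul]
        exact congrArg piKronecker (funext hPY)
      have hpsd : (M.toBlocks₂₂ - piKronecker Y).PosSemidef := by
        rw [hM22, hG, hK, mul_conjTranspose_sub_mul_diagonal_mul]
        refine PosSemidef.mul_mul_conjTranspose_same (PosSemidef.diagonal fun a => ?_) _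
        simp only [Pi.zero_apply, Complex.zero_le_real, sub_nonneg]
        exact prod_le_one (fun p _ => hy0 p _) fun p _ => (hy1 p _).le
      have h := hpsd.det_le_det_add hYM
      rw [sub_add_sub_cancel] at h
      rwa [hM22, hG, hK, det_mul_conjTranspose_sub_mul_diagonal_mul, ← hG, ← hM22] at h
    refine ⟨fun p => Fin.snoc (α := fun _ => τ p → ℝ) (x' p) (y p), fun p k => ?_,
      fun p k => ?_, fun p k => ?_, fun p => ?_, ?_⟩
    · induction k using Fin.lastCases with
      | last => simpa using hy0 p
      | cast k => simpa using h0' p k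
    · induction k using Fin.lastCases with
      | last => simpa using hy1 p
      | cast k => simpa using h1' p k
    · induction k using Fin.lastCases with
      | last =>
        intro hz l hl a b
        simp only [Fin.snoc_last] at hz
        have hYp : Y p = 0 := by
          rw [hPY p]
          simp [hz]
        obtain ⟨l, rfl⟩ := Fin.exists_castSucc_eq.2 hl.ne
        exact congrFun (congrFun (hY0 p hYp) (l, a)) b
      | cast k =>
        intro hz l hl a b
        simp only [Fin.snoc_castSucc] at hz
        obtain ⟨l, rfl⟩ := Fin.exists_castSucc_eq.2 (hl.trans (Fin.castSucc_lt_last k)).ne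
        exact hz' p k hz l (Fin.castSucc_lt_castSucc_iff.1 hl) a b
    · rw [← det_submatrix_equiv_self (finSuccProdEquiv s (τ p)), hdet p, hd' p]
      have h : ((N p).toBlocks₂₂ - Y p).det
          = (N p).toBlocks₂₂.det * ((∏ a, (1 - y p a) : ℝ) : ℂ) := by
        conv_lhs => rw [hPG p, hPY p]
        rw [det_mul_conjTranspose_sub_mul_diagonal_mul, ← hPG p]
      rw [h, Fin.prod_univ_castSucc, Fin.prod_univ_castSucc]
      simp only [Fin.snoc_last, Fin.snoc_castSucc, Complex.ofReal_mul]
      have e1 : ∀ k, diagBlock (N p).toBlocks₁₁ k = diagBlock (A p) k.castSucc := fun _ => rfl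
      have e2 : (N p).toBlocks₂₂ = diagBlock (A p) (Fin.last s) := rfl
      simp only [e1, e2]
      ring
    · rw [← det_submatrix_equiv_self (finSuccProdEquiv s (∀ p, τ p)), ← hMdef, hdetM, hM11]
      have h := mul_le_mul hb' hlast (mul_nonneg
        (hM.submatrix Sum.inr_injective : M.toBlocks₂₂.PosDef).det_pos.le (by
          rw [Complex.zero_le_real]
          exact prod_nonneg fun a _ => sub_nonneg.2
            (prod_le_one (fun p _ => hy0 p _) fun p _ => (hy1 p _).le)))
        (PosDef.khatriRao fun p => (hN p).submatrix Sum.inl_injective).det_pos.le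
      refine le_trans (le_of_eq ?_) h
      rw [hM22, Fin.prod_univ_castSucc, Fin.prod_univ_castSucc]
      simp only [Fin.snoc_last, Fin.snoc_castSucc, Complex.ofReal_mul]
      have e1 : ∀ k, (fun p => diagBlock (N p).toBlocks₁₁ k)
        = fun p => diagBlock (A p) k.castSucc := fun _ => rfl
      have e2 : (fun p => (N p).toBlocks₂₂) = fun p => diagBlock (A p) (Fin.last s) := rfl
      simp only [e1, e2]
      ring

/-- The lower bound in the Oppenheim–Schur inequality for the Khatri–Rao product. -/
def oppenheimBound {ι : Type*} [Fintype ι] [DecidableEq ι]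
    (A : ∀ p, Matrix (ι × τ p) (ι × τ p) ℂ) : ℝ :=
  (∏ p, ∏ k, (diagBlock (A p) k).det.re ^ ∏ q ∈ univ.erase p, Fintype.card (τ q)) -
    ∏ p, ((∏ k, (diagBlock (A p) k).det.re ^ ∏ q ∈ univ.erase p, Fintype.card (τ q)) -
      (A p).det.re ^ ∏ q ∈ univ.erase p, Fintype.card (τ q))

theorem Matrix.PosDef.ofReal_re_det {n : Type*} [Fintype n] [DecidableEq n] {A : Matrix n n ℂ}
    (hA : A.PosDef) : ((A.det.re : ℝ) : ℂ) = A.det :=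
  Complex.ext rfl (Complex.lt_def.1 hA.det_pos).2

theorem re_det_khatriRao_eq_oppenheimBound_iff [Nonempty κ] {ι : Type*} [Fintype ι] [DecidableEq ι]
    {A : ∀ p, Matrix (ι × τ p) (ι × τ p) ℂ} (hA : ∀ p, (A p).PosDef) :
    (khatriRao A).det.re = oppenheimBound A ↔ (khatriRao A).det =
      (∏ p, ∏ k, (diagBlock (A p) k).det ^ ∏ q ∈ univ.erase p, Fintype.card (τ q)) -
        ∏ p, ((∏ k, (diagBlock (A p) k).det ^ ∏ q ∈ univ.erase p, Fintype.card (τ q)) -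
          (A p).det ^ ∏ q ∈ univ.erase p, Fintype.card (τ q)) := by
  rw [← Complex.ofReal_inj, (PosDef.khatriRao hA).ofReal_re_det, oppenheimBound]
  push_cast
  simp only [fun p => (hA p).ofReal_re_det, fun p k => ((hA p).diagBlock k).ofReal_re_det]

theorem exists_of_det_eq_oppenheimBound [Nonempty κ] {s : ℕ}
    {A : ∀ p, Matrix (Fin s × τ p) (Fin s × τ p) ℂ} (hA : ∀ p, (A p).PosDef)
    (h : (khatriRao A).det.re = oppenheimBound A) :
    ∃ x : ∀ p, Fin s → τ p → ℝ, (∀ p k a, 0 ≤ x p k a) ∧ (∀ p k a, x p k a < 1) ∧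
      (∀ p k, (∀ a, x p k a = 0) → ∀ l < k, ∀ a b, A p (l, a) (k, b) = 0) ∧
      ∏ i : Fin s × ∀ p, τ p, (1 - ∏ p, x p i.1 (i.2 p))
        = 1 - ∏ p, (1 - ∏ i : Fin s × ∀ p, τ p, (1 - x p i.1 (i.2 p))) := by
  obtain ⟨x, h0, h1, hz, hd, hb⟩ := exists_khatriRao_det_bound s A hA
  refine ⟨x, h0, h1, hz, le_antisymm ?_ ?_⟩
  · have hfib : ∀ p k, ∏ a : ∀ p, τ p, (1 - x p k (a p))
        = (∏ b, (1 - x p k b)) ^ ∏ q ∈ univ.erase p, Fintype.card (τ q) := fun p k =>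
      prod_pi_apply p fun b => 1 - x p k b
    simp only [Fintype.prod_prod_type, hfib]
    have hdr : ∀ p, (A p).det.re
        = (∏ k, (diagBlock (A p) k).det.re) * ∏ k, ∏ a, (1 - x p k a) := fun p => by
      rw [← Complex.ofReal_inj, (hA p).ofReal_re_det, hd p]
      push_cast
      simp only [fun p k => ((hA p).diagBlock k).ofReal_re_det]
    have hD : 0 < ∏ p, ∏ k,
        (diagBlock (A p) k).det.re ^ ∏ q ∈ univ.erase p, Fintype.card (τ q) :=
      prod_pos fun p _ => prod_pos fun k _ =>
        pow_pos (Complex.lt_def.1 ((hA p).diagBlock k).det_pos).1 _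
    rw [← mul_le_mul_iff_right₀ hD]
    have hbr := hb
    simp only [fun k => PosSemidef.det_piKronecker fun p => ((hA p).diagBlock k).posSemidef]
      at hbr
    have hcast : ∏ k, ∏ p, (diagBlock (A p) k).det ^ ∏ q ∈ univ.erase p, Fintype.card (τ q)
        = ((∏ p, ∏ k, (diagBlock (A p) k).det.re ^
            ∏ q ∈ univ.erase p, Fintype.card (τ q) : ℝ) : ℂ) := by
      push_cast
      simp only [fun p k => ((hA p).diagBlock k).ofReal_re_det]
      exact prod_comm
    rw [← (PosDef.khatriRao hA).ofReal_re_det, h, hcast, oppenheimBound] at hbr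
    refine le_trans (by exact_mod_cast hbr) (le_of_eq ?_)
    rw [mul_sub, mul_one, ← prod_mul_distrib]
    congr 1
    refine prod_congr rfl fun p _ => ?_
    rw [hdr p, mul_pow, prod_pow, prod_pow]
    ring
  · exact one_sub_prod_le_prod_one_sub (fun p (i : Fin s × ∀ p, τ p) => x p i.1 (i.2 p))
      (fun _ _ => h0 _ _ _) (fun _ _ => h1 _ _ _) univ

/-- A block matrix is block diagonal if its off-diagonal blocks vanish. -/
def IsBlockDiag {ι β : Type*} (A : Matrix (ι × β) (ι × β) ℂ) : Prop :=
  ∀ i j, i ≠ j → ∀ x y, A (i, x) (j, y) = 0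

theorem Matrix.IsHermitian.isBlockDiag {ι β : Type*} [LinearOrder ι]
    {A : Matrix (ι × β) (ι × β) ℂ} (hA : A.IsHermitian)
    (h : ∀ k, ∀ l < k, ∀ a b, A (l, a) (k, b) = 0) : IsBlockDiag A := by
  intro i j hij a b
  rcases lt_or_gt_of_ne hij with hlt | hlt
  · exact h j i hlt a b
  · rw [← hA.apply, h i j hlt, star_zero]

theorem subsingleton_and_exists_row [Nontrivial κ] {s : ℕ}
    {A : ∀ p, Matrix (Fin s × τ p) (Fin s × τ p) ℂ} (hA : ∀ p, (A p).PosDef)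
    (hnd : ∀ p, ¬ IsBlockDiag (A p)) (h : (khatriRao A).det.re = oppenheimBound A) :
    (∀ p, Subsingleton (τ p)) ∧
      ∃ k₀, ∀ p k, k ≠ k₀ → ∀ l < k, ∀ a b, A p (l, a) (k, b) = 0 := by
  obtain ⟨x, h0, h1, hz, heq⟩ := exists_of_det_eq_oppenheimBound hA h
  have hne : ∀ p, ∃ k a, 0 < x p k a := fun p => by
    by_contra! hc
    exact hnd p ((hA p).1.isBlockDiag fun k l hl a b =>
      hz p k (fun a => le_antisymm (hc k a) (h0 p k a)) l hl a b)
  choose k c hkc using hne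
  have hkey : ∀ {p q : κ} (_ : p ≠ q) {i j : Fin s × ∀ p, τ p}, 0 < x p i.1 (i.2 p) →
      0 < x q j.1 (j.2 q) → i = j := fun hpq i j hp hq =>
    eq_of_one_sub_prod_eq (fun p (i : Fin s × ∀ p, τ p) => x p i.1 (i.2 p))
      (fun _ _ => h0 _ _ _) (fun _ _ => h1 _ _ _) (fun p => ⟨(k p, c), hkc p⟩) heq hpq hp hq
  have hrow : ∀ {p q : κ} (_ : p ≠ q) {i a}, 0 < x p i a → i = k q := fun {p q} hpq i a hp =>
    congrArg Prod.fst (hkey hpq (i := (i, Function.update c p a)) (j := (k q, c))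
      (by simpa using hp) (hkc q))
  refine ⟨fun q => ?_, ?_⟩
  · obtain ⟨r, hr⟩ := exists_ne q
    refine subsingleton_of_forall_eq (c q) fun a => ?_
    have := hkey hr (i := (k r, Function.update c q a)) (j := (k q, c))
      (by simpa [Function.update_of_ne hr] using hkc r) (hkc q)
    simpa using congrFun (congrArg Prod.snd this) q
  · obtain ⟨p₀⟩ := (inferInstance : Nonempty κ)
    refine ⟨k p₀, fun p i hi l hl a b => hz p i (fun d => ?_) l hl a b⟩
    by_contra hd
    have hpos := lt_of_le_of_ne (h0 p i d) (Ne.symm hd)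
    obtain ⟨q, hq⟩ := exists_ne p
    apply hi
    by_cases hp : p = p₀
    · subst hp
      rw [hrow hq.symm hpos, hrow hq (hkc q)]
    · exact hrow hp hpos

omit [DecidableEq κ] [∀ p, Fintype (τ p)] [∀ p, DecidableEq (τ p)] in
theorem khatriRao_submatrix_perm {ι : Type*} (A : ∀ p, Matrix (ι × τ p) (ι × τ p) ℂ)
    (σ : Equiv.Perm ι) :
    khatriRao (fun p => (A p).submatrix (σ.prodCongr (Equiv.refl (τ p)))
        (σ.prodCongr (Equiv.refl (τ p))))
      = (khatriRao A).submatrix (σ.prodCongr (Equiv.refl _)) (σ.prodCongr (Equiv.refl _)) :=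
  rfl

theorem oppenheimBound_submatrix_perm {ι : Type*} [Fintype ι] [DecidableEq ι]
    (A : ∀ p, Matrix (ι × τ p) (ι × τ p) ℂ) (σ : Equiv.Perm ι) :
    oppenheimBound (fun p => (A p).submatrix (σ.prodCongr (Equiv.refl (τ p)))
        (σ.prodCongr (Equiv.refl (τ p)))) = oppenheimBound A := by
  have h : ∀ p, ∏ k, (diagBlock ((A p).submatrix (σ.prodCongr (Equiv.refl (τ p)))
        (σ.prodCongr (Equiv.refl (τ p)))) k).det.re ^ ∏ q ∈ univ.erase p, Fintype.card (τ q)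
      = ∏ k, (diagBlock (A p) k).det.re ^ ∏ q ∈ univ.erase p, Fintype.card (τ q) := fun p =>
    Equiv.prod_comp σ fun k =>
      (diagBlock (A p) k).det.re ^ ∏ q ∈ univ.erase p, Fintype.card (τ q)
  simp only [oppenheimBound, h, det_submatrix_equiv_self]

theorem eq_zero_of_det_eq_oppenheimBound [Nontrivial κ] {s : ℕ}
    {A : ∀ p, Matrix (Fin s × τ p) (Fin s × τ p) ℂ} (hA : ∀ p, (A p).PosDef)
    (hnd : ∀ p, ¬ IsBlockDiag (A p)) (h : (khatriRao A).det.re = oppenheimBound A)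
    {p : κ} {i j : Fin s} (hij : i ≠ j) {a b : τ p} (hp : A p (i, a) (j, b) ≠ 0)
    (q : κ) {v w : Fin s} (hvw : v ≠ w) (hvi : v ≠ i) (hvj : v ≠ j) (c d : τ q) :
    A q (v, c) (w, d) = 0 := by
  by_contra hq
  obtain _ | s := s
  · exact i.elim0
  set σ := Equiv.swap (Fin.last s) v with hσ
  set B : ∀ p, Matrix (Fin (s + 1) × τ p) (Fin (s + 1) × τ p) ℂ :=
    fun p => (A p).submatrix (σ.prodCongr (Equiv.refl (τ p))) (σ.prodCongr (Equiv.refl (τ p)))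
    with hB
  have hBapply : ∀ p k l a b, B p (σ.symm k, a) (σ.symm l, b) = A p (k, a) (l, b) :=
    fun p k l a b => by simp [hB]
  have hBpos : ∀ p, (B p).PosDef := fun p => (hA p).submatrix (Equiv.injective _)
  have hBnd : ∀ p, ¬ IsBlockDiag (B p) := fun p hp => hnd p fun k l hkl a b => by
    rw [← hBapply]
    exact hp _ _ (σ.symm.injective.ne hkl) a b
  have hBeq : (khatriRao B).det.re = oppenheimBound B := by
    rw [oppenheimBound_submatrix_perm A σ, khatriRao_submatrix_perm A σ,
      det_submatrix_equiv_self, h]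
  obtain ⟨-, k₀, hk₀⟩ := subsingleton_and_exists_row hBpos hBnd hBeq
  have hv : σ.symm v = Fin.last s := by simp [hσ]
  have hlt : ∀ k, v ≠ k → σ.symm k < Fin.last s := fun k hk =>
    Fin.lt_last_iff_ne_last.2 fun h => hk (σ.symm.injective (hv.trans h.symm))
  have hlast : Fin.last s = k₀ := by
    by_contra hne
    apply hq
    rw [← (hA q).1.apply, ← hBapply, hv, hk₀ q _ hne _ (hlt w hvw), star_zero]
  have hzero := fun k l (hl : v ≠ l) a b (hkl : σ.symm k < σ.symm l) =>
    hk₀ p (σ.symm l) (by rw [← hlast]; exact (hlt l hl).ne) (σ.symm k) hkl a b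
  rcases lt_or_gt_of_ne (σ.symm.injective.ne hij) with hl | hl
  · exact hp (by rw [← hBapply, hzero i j hvj a b hl])
  · exact hp (by rw [← (hA p).1.apply, ← hBapply, hzero j i hvi b a hl, star_zero])

theorem IsBlockDiag.det_eq {ι β : Type*} [Fintype ι] [DecidableEq ι] [Fintype β] [DecidableEq β]
    {A : Matrix (ι × β) (ι × β) ℂ} (hA : IsBlockDiag A) :
    A.det = ∏ k, (diagBlock A k).det := by
  rw [← det_blockDiagonal, ← det_submatrix_equiv_self (Equiv.prodComm ι β)]
  congr 1
  ext ⟨i, a⟩ ⟨j, b⟩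
  by_cases hij : i = j
  · subst hij
    simp [diagBlock]
  · simp [blockDiagonal_apply, hij, hA i j hij]

omit [DecidableEq κ] [∀ p, Fintype (τ p)] [∀ p, DecidableEq (τ p)] in
theorem IsBlockDiag.khatriRao {ι : Type*} {A : ∀ p, Matrix (ι × τ p) (ι × τ p) ℂ} {p : κ}
    (hp : IsBlockDiag (A p)) : IsBlockDiag (khatriRao A) :=
  fun i j hij _ _ => prod_eq_zero (mem_univ p) (hp i j hij _ _)

theorem det_eq_oppenheimBound_of_isBlockDiag {ι : Type*} [Fintype ι] [DecidableEq ι]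
    {A : ∀ p, Matrix (ι × τ p) (ι × τ p) ℂ} (hA : ∀ p, (A p).PosDef) {p : κ}
    (hp : IsBlockDiag (A p)) : (khatriRao A).det.re = oppenheimBound A := by
  have : Nonempty κ := ⟨p⟩
  have hzero : ∏ p, ((∏ k, (diagBlock (A p) k).det ^ ∏ q ∈ univ.erase p, Fintype.card (τ q)) -
      (A p).det ^ ∏ q ∈ univ.erase p, Fintype.card (τ q)) = 0 :=
    prod_eq_zero (mem_univ p) (by rw [hp.det_eq, prod_pow, sub_self])
  rw [re_det_khatriRao_eq_oppenheimBound_iff hA, hp.khatriRao.det_eq, hzero, sub_zero, prod_comm]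
  exact prod_congr rfl fun k _ =>
    PosSemidef.det_piKronecker fun p => ((hA p).diagBlock k).posSemidef

theorem det_of_forall_ne_eq_zero {ι : Type*} [Fintype ι] [DecidableEq ι] {B : Matrix ι ι ℂ}
    {i j : ι} (hij : i ≠ j)
    (hB : ∀ k l, k ≠ l → ¬((k = i ∧ l = j) ∨ (k = j ∧ l = i)) → B k l = 0) :
    B.det = ∏ k, B k k - (∏ k ∈ (univ.erase i).erase j, B k k) * (B i j * B j i) := by
  rw [det_apply, sum_eq_add 1 (Equiv.swap i j)]
  · have h1 : ∏ k, B (Equiv.swap i j k) k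
        = (∏ k ∈ (univ.erase i).erase j, B k k) * (B i j * B j i) := by
      rw [← mul_prod_erase univ _ (mem_univ i),
        ← mul_prod_erase (univ.erase i) _ (mem_erase.2 ⟨hij.symm, mem_univ j⟩)]
      have : ∏ k ∈ (univ.erase i).erase j, B (Equiv.swap i j k) k
          = ∏ k ∈ (univ.erase i).erase j, B k k := prod_congr rfl fun k hk => by
        simp only [mem_erase, mem_univ, and_true] at hk
        rw [Equiv.swap_apply_of_ne_of_ne hk.2 hk.1]
      rw [this, Equiv.swap_apply_left, Equiv.swap_apply_right]
      ring
    rw [h1, Equiv.Perm.sign_swap hij]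
    simp [sub_eq_add_neg]
  · intro h
    have := congrArg (fun σ => σ i) h
    simp [hij] at this
  · rintro σ - ⟨hσ1, hσ2⟩
    suffices ∃ k, B (σ k) k = 0 by
      obtain ⟨k, hk⟩ := this
      have h0 : ∏ k, B (σ k) k = 0 := prod_eq_zero (mem_univ k) hk
      rw [h0, smul_zero]
    by_contra! hne
    have hk : ∀ k, σ k = k ∨ (σ k = i ∧ k = j) ∨ (σ k = j ∧ k = i) := fun k => by
      by_contra! hc
      exact hne k (hB _ _ hc.1 (by tauto))
    have hfix : ∀ k, k ≠ i → k ≠ j → σ k = k := fun k hi hj => by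
      rcases hk k with h | h | h
      · exact h
      · exact absurd h.2 hj
      · exact absurd h.2 hi
    rcases hk i with hi | hi | hi
    · apply hσ1
      ext k
      rcases hk k with h | h | h
      · exact h
      · exact absurd (σ.injective (hi.trans h.1.symm)) (h.2 ▸ hij)
      · exact absurd (hi.symm.trans (h.2 ▸ h.1)) hij
    · exact hij hi.2
    · apply hσ2
      ext k
      by_cases hki : k = i
      · rw [hki, hi.1, Equiv.swap_apply_left]
      · by_cases hkj : k = j
        · rw [hkj, Equiv.swap_apply_right]
          rcases hk j with h | h | h
          · exact absurd (σ.injective (hi.1.trans h.symm)) hij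
          · exact h.1
          · exact absurd h.2 hij.symm
        · rw [hfix k hki hkj, Equiv.swap_apply_of_ne_of_ne hki hkj]
  · simp
  · simp

theorem det_prod_unique {ι β : Type*} [Fintype ι] [DecidableEq ι] [Unique β] [Fintype β]
    [DecidableEq β] (A : Matrix (ι × β) (ι × β) ℂ) {i j : ι} (hij : i ≠ j)
    (hA : ∀ k l, k ≠ l → ¬((k = i ∧ l = j) ∨ (k = j ∧ l = i)) →
      A (k, default) (l, default) = 0) :
    A.det = ∏ k, (diagBlock A k).det - (∏ k ∈ (univ.erase i).erase j, (diagBlock A k).det) *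
      (A (i, default) (j, default) * A (j, default) (i, default)) := by
  have h := det_of_forall_ne_eq_zero (B := A.submatrix (fun k => (k, default))
    fun k => (k, default)) hij hA
  rw [← det_submatrix_equiv_self (Equiv.prodUnique ι β).symm]
  simp only [det_unique]
  exact h

theorem det_eq_oppenheimBound_of_forall_eq_zero [Nonempty κ] [∀ p, Unique (τ p)]
    {ι : Type*} [Fintype ι] [DecidableEq ι]
    {A : ∀ p, Matrix (ι × τ p) (ι × τ p) ℂ} (hA : ∀ p, (A p).PosDef) {i j : ι} (hij : i ≠ j)
    (h : ∀ p k l, k ≠ l → ¬((k = i ∧ l = j) ∨ (k = j ∧ l = i)) →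
      ∀ x y, A p (k, x) (l, y) = 0) : (khatriRao A).det.re = oppenheimBound A := by
  obtain ⟨p₀⟩ := ‹Nonempty κ›
  have : Nonempty κ := ⟨p₀⟩
  rw [re_det_khatriRao_eq_oppenheimBound_iff hA, det_prod_unique (khatriRao A) hij fun k l hkl hc =>
    prod_eq_zero (mem_univ p₀) (h p₀ k l hkl hc _ _)]
  have hK : ∀ k, (diagBlock (khatriRao A) k).det = ∏ p, (diagBlock (A p) k).det := fun k => by
    simp only [det_unique]
    rfl
  simp only [Fintype.card_unique, prod_const_one, pow_one, hK]
  congr 1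
  · exact prod_comm
  · rw [prod_comm]
    simp only [khatriRao, of_apply]
    rw [← prod_mul_distrib, ← prod_mul_distrib]
    refine prod_congr rfl fun p _ => ?_
    rw [det_prod_unique (A p) hij fun k l hkl hc => h p k l hkl hc _ _]
    simp only [sub_sub_cancel]
    rfl

theorem det_eq_oppenheimBound_of_unique [Unique κ] {ι : Type*} [Fintype ι] [DecidableEq ι]
    (A : ∀ p, Matrix (ι × τ p) (ι × τ p) ℂ) : (khatriRao A).det.re = oppenheimBound A := by
  have h : (khatriRao A).det = (A default).det := by
    rw [← det_submatrix_equiv_self ((Equiv.refl ι).prodCongr (Equiv.piUnique τ)) (A default)]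
    congr 1
    ext x y
    simp only [khatriRao, of_apply, univ_unique, prod_singleton]
    rfl
  simp [oppenheimBound, h]

end KhatriRao

/-- Equality condition in the Oppenheim–Schur inequality for the Khatri–Rao
product `M = A¹ ∗ ⋯ ∗ Aᵐ` of positive definite `s × s` block matrices `Aᵖ` with
blocks of size `t p × t p` (`σ p = ∏_{q ≠ p} t q`): equality holds in
`det M ≥ ∏_p ∏_i det(Aᵖᵢᵢ)^{σ_p} − ∏_p (∏_i det(Aᵖᵢᵢ)^{σ_p} − det(Aᵖ)^{σ_p})`
iff (a) `m = 1` or `s = 1`; or (b) some `Aᵖ` is block diagonal; or (c) every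
`t p = 1` and there are `i ≠ j` such that for every `p` all off-diagonal entries
of `Aᵖ` outside positions `(i, j)` and `(j, i)` vanish. -/
theorem stmt_15 {m s : ℕ} (hm : 1 ≤ m) (t : Fin m → ℕ)
    (A : ∀ p : Fin m, Matrix (Fin s × Fin (t p)) (Fin s × Fin (t p)) ℂ)
    (hA : ∀ p, (A p).PosDef)
    (M : Matrix (Fin s × ∀ p, Fin (t p)) (Fin s × ∀ p, Fin (t p)) ℂ)
    (hM : ∀ x y, M x y = ∏ p, A p (x.1, x.2 p) (y.1, y.2 p)) :
    M.det.re
        = (∏ p, ∏ i : Fin s,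
            (Matrix.of fun x y : Fin (t p) => A p (i, x) (i, y)).det.re
              ^ ∏ q ∈ Finset.univ.erase p, t q) -
          ∏ p, ((∏ i : Fin s,
              (Matrix.of fun x y : Fin (t p) => A p (i, x) (i, y)).det.re
                ^ ∏ q ∈ Finset.univ.erase p, t q) -
            (A p).det.re ^ ∏ q ∈ Finset.univ.erase p, t q)
      ↔ (m = 1 ∨ s = 1) ∨
        (∃ p, ∀ i j : Fin s, i ≠ j →
          ∀ (x y : Fin (t p)), A p (i, x) (j, y) = 0) ∨
        ((∀ p, t p = 1) ∧ ∃ i j : Fin s, i ≠ j ∧ ∀ p, ∀ k l : Fin s, k ≠ l →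
          ¬((k = i ∧ l = j) ∨ (k = j ∧ l = i)) →
          ∀ (x y : Fin (t p)), A p (k, x) (l, y) = 0) := by
  obtain rfl : M = khatriRao A := by ext x y; exact hM x y
  have hbound : (khatriRao A).det.re
        = (∏ p, ∏ i : Fin s,
            (Matrix.of fun x y : Fin (t p) => A p (i, x) (i, y)).det.re
              ^ ∏ q ∈ Finset.univ.erase p, t q) -
          ∏ p, ((∏ i : Fin s,
              (Matrix.of fun x y : Fin (t p) => A p (i, x) (i, y)).det.re
                ^ ∏ q ∈ Finset.univ.erase p, t q) -
            (A p).det.re ^ ∏ q ∈ Finset.univ.erase p, t q)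
      ↔ (khatriRao A).det.re = oppenheimBound A := by
    simp only [oppenheimBound, Fintype.card_fin, diagBlock]
  rw [hbound]
  constructor
  · intro h
    by_cases hm1 : m = 1
    · exact Or.inl (Or.inl hm1)
    refine Or.inr ?_
    by_cases hbd : ∃ p, IsBlockDiag (A p)
    · exact Or.inl hbd
    push Not at hbd
    have : Nontrivial (Fin m) := Fin.nontrivial_iff_two_le.2 (by omega)
    have hsub := (subsingleton_and_exists_row hA hbd h).1
    have hedge : ∀ p, ∃ i j, i ≠ j ∧ ∃ a b, A p (i, a) (j, b) ≠ 0 := fun p => by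
      by_contra! hc
      exact hbd p hc
    refine Or.inr ⟨fun p => ?_, ?_⟩
    · obtain ⟨-, -, -, a, -⟩ := hedge p
      exact le_antisymm (Fin.subsingleton_iff_le_one.1 (hsub p)) a.pos
    · obtain ⟨i, j, hij, a, b, hab⟩ := hedge ⟨0, hm⟩
      refine ⟨i, j, hij, fun p k l hkl hc x y => ?_⟩
      have hzero := @eq_zero_of_det_eq_oppenheimBound _ _ _ _ _ _ _ _ _ hA hbd h _ _ _ hij
        _ _ hab p
      by_cases hk : k ≠ i ∧ k ≠ j
      · exact hzero hkl hk.1 hk.2 x y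
      · have hl : l ≠ i ∧ l ≠ j := by
          by_contra hl
          rcases (by tauto : k = i ∨ k = j) with hk' | hk' <;>
            rcases (by tauto : l = i ∨ l = j) with hl' | hl'
          · exact hkl (hk'.trans hl'.symm)
          · exact hc (Or.inl ⟨hk', hl'⟩)
          · exact hc (Or.inr ⟨hk', hl'⟩)
          · exact hkl (hk'.trans hl'.symm)
        rw [← (hA p).1.apply, hzero hkl.symm hl.1 hl.2 y x, star_zero]
  · rintro ((rfl | rfl) | ⟨p, hp⟩ | ⟨ht, i, j, hij, hA0⟩)
    · exact det_eq_oppenheimBound_of_unique A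
    · exact det_eq_oppenheimBound_of_isBlockDiag (p := ⟨0, hm⟩) hA
        fun i j hij => absurd (Subsingleton.elim i j) hij
    · exact det_eq_oppenheimBound_of_isBlockDiag hA hp
    · have : Nonempty (Fin m) := ⟨⟨0, hm⟩⟩
      obtain rfl : t = fun _ => 1 := funext ht
      exact det_eq_oppenheimBound_of_forall_eq_zero hA hij hA0
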